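/- Let E : O → ℝ be an expectation-value functional on observables (identified with bounded self-adjoint operators on a separable Hilbert space H) satisfying: positivity (E(A) ≥ 0 whenever A ≥ 0), countable additivity/linearity with respect to strongly convergent sums of bounded self-adjoint operators, and E(1) < ∞. Then there exists a positive trace-class operator U such that E(A) = Tr(UA) for all bounded self-adjoint A. Conversely, for any positive trace-class U, A ↦ Tr(UA) satisfies these properties. -/

import Mathlib

open scoped InnerProductSpace

/-- The trace of `U * A` computed along the Hilbert basis `b`, i.e. `Tr(UA)`. -/
noncomputable def trExp {H : Type*} [NormedAddCommGroup H] [InnerProductSpace ℂ H]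
    [CompleteSpace H] {ι : Type*} (b : HilbertBasis ι ℂ H) (U A : H →L[ℂ] H) : ℝ :=
  ∑' i, (⟪b i, (U * A) (b i)⟫_ℂ).re

open InnerProductSpace ComplexStarModule

section VNHelpers

variable {H : Type*} [NormedAddCommGroup H] [InnerProductSpace ℂ H] [CompleteSpace H]

/-- Countable linearity of a functional with respect to strong convergence. -/
def VNLin (E : (H →L[ℂ] H) → ℝ) : Prop :=
  ∀ (A : H →L[ℂ] H) (As : ℕ → H →L[ℂ] H) (c : ℕ → ℝ),
    IsSelfAdjoint A → (∀ k, IsSelfAdjoint (As k)) →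
    (∀ x : H, HasSum (fun k => c k • As k x) (A x)) →
    HasSum (fun k => c k * E (As k)) (E A)

lemma VNLin.zero {E : (H →L[ℂ] H) → ℝ} (h : VNLin E) : E 0 = 0 := by
  have := h 0 (fun _ => 0) (fun _ => 0) (.zero _) (fun _ => .zero _) (by simp)
  simp only [zero_mul] at this
  exact this.unique hasSum_zero

lemma VNLin.lin {E : (H →L[ℂ] H) → ℝ} (h : VNLin E) {A B : H →L[ℂ] H} (hA : IsSelfAdjoint A)
    (hB : IsSelfAdjoint B) (s t : ℝ) : E (s • A + t • B) = s * E A + t * E B := by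
  let As : ℕ → H →L[ℂ] H := fun k => if k = 0 then A else if k = 1 then B else 0
  let c : ℕ → ℝ := fun k => if k = 0 then s else if k = 1 then t else 0
  have hc : ∀ k, k ∉ Finset.range 2 → c k = 0 := by
    intro k hk
    simp only [Finset.mem_range, not_lt] at hk
    simp only [c]
    rw [if_neg (by omega), if_neg (by omega)]
  have h1 := h (s • A + t • B) As c
    (((IsSelfAdjoint.all s).smul hA).add ((IsSelfAdjoint.all t).smul hB))
    (by intro k; simp only [As]; split_ifs <;> first | assumption | exact .zero _)
    (by
      intro x
      have := hasSum_sum_of_ne_finset_zero (L := .unconditional ℕ) (f := fun k => c k • As k x) (s := Finset.range 2)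
        (fun k hk => by simp [hc k hk])
      simpa [Finset.sum_range_succ, As, c] using this)
  have h2 := hasSum_sum_of_ne_finset_zero (L := .unconditional ℕ) (f := fun k => c k * E (As k)) (s := Finset.range 2)
        (fun k hk => by simp [hc k hk])
  have h3 := h1.unique h2
  simpa [Finset.sum_range_succ, As, c] using h3

lemma VNLin.hasSum {E : (H →L[ℂ] H) → ℝ} (h : VNLin E) {ι : Type*} [Countable ι]
    {A : H →L[ℂ] H} {As : ι → H →L[ℂ] H} (hA : IsSelfAdjoint A)
    (hAs : ∀ k, IsSelfAdjoint (As k)) (hs : ∀ x : H, HasSum (fun k => As k x) (A x)) :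
    HasSum (fun k => E (As k)) (E A) := by
  obtain ⟨f, hf⟩ := exists_injective_nat ι
  have hval : ∀ k, Function.extend f As 0 (f k) = As k := fun k => hf.extend_apply _ _ _
  have hnot : ∀ n, n ∉ Set.range f → Function.extend f As 0 n = 0 := by
    intro n hn
    rw [Function.extend_apply' _ _ _ (by simpa using hn)]; rfl
  have h1 := h A (Function.extend f As 0) (fun _ => 1) hA
    (by
      intro k
      by_cases hk : k ∈ Set.range f
      · obtain ⟨i, rfl⟩ := hk
        rw [hval]; exact hAs i
      · rw [hnot k hk]; exact .zero _)
    (by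
      intro x
      rw [← hf.hasSum_iff]
      · simpa [Function.comp_def, hval] using hs x
      · intro n hn
        simp [hnot n hn])
  rw [← hf.hasSum_iff] at h1
  · simpa [Function.comp_def, hval] using h1
  · intro n hn
    simp [hnot n hn, h.zero]

lemma VNLin.bound {E : (H →L[ℂ] H) → ℝ} (h : VNLin E)
    (hp : ∀ A : H →L[ℂ] H, A.IsPositive → 0 ≤ E A) {A : H →L[ℂ] H} (hA : IsSelfAdjoint A) :
    |E A| ≤ E 1 * ‖A‖ := by
  have h1 := hA.le_algebraMap_norm_self
  have h2 := hA.neg.le_algebraMap_norm_self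
  rw [ContinuousLinearMap.le_def] at h1 h2
  have e1 := h.lin (IsSelfAdjoint.one (H →L[ℂ] H)) hA ‖A‖ (-1)
  have e2 := h.lin (IsSelfAdjoint.one (H →L[ℂ] H)) hA ‖A‖ 1
  have p1 := hp _ h1
  have p2 := hp _ h2
  rw [Algebra.algebraMap_eq_smul_one] at p1 p2
  rw [show ‖A‖ • (1 : H →L[ℂ] H) - A = ‖A‖ • (1 : H →L[ℂ] H) + (-1 : ℝ) • A by
    rw [neg_one_smul, sub_eq_add_neg], e1] at p1
  rw [norm_neg, show ‖A‖ • (1 : H →L[ℂ] H) - -A = ‖A‖ • (1 : H →L[ℂ] H) + (1 : ℝ) • A by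
    rw [one_smul, sub_neg_eq_add], e2] at p2
  rw [abs_le]
  constructor <;> linarith

/-- The complex-linear extension of `E`. -/
lemma VNLin.exists_ext {E : (H →L[ℂ] H) → ℝ} (h : VNLin E)
    (hp : ∀ A : H →L[ℂ] H, A.IsPositive → 0 ≤ E A) :
    ∃ F : (H →L[ℂ] H) →L[ℂ] ℂ, ∀ T, F T = (E (ℜ T : H →L[ℂ] H) : ℂ) + (E (ℑ T : H →L[ℂ] H) : ℂ) * Complex.I := by
  have hadd : ∀ A B : selfAdjoint (H →L[ℂ] H), E ((A + B : selfAdjoint (H →L[ℂ] H)) : H →L[ℂ] H) = E A + E B := by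
    intro A B
    simpa using h.lin A.2 B.2 1 1
  have hE1 : 0 ≤ E 1 := hp _ ContinuousLinearMap.isPositive_one
  let L : (H →L[ℂ] H) →ₗ[ℂ] ℂ :=
    { toFun := fun T => (E (ℜ T : H →L[ℂ] H) : ℂ) + (E (ℑ T : H →L[ℂ] H) : ℂ) * Complex.I
      map_add' := by
        intro S T
        simp only [map_add, hadd]
        push_cast; ring
      map_smul' := by
        intro z T
        have r1 : E (ℜ (z • T) : H →L[ℂ] H) = z.re * E (ℜ T : H →L[ℂ] H) - z.im * E (ℑ T : H →L[ℂ] H) := by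
          rw [realPart_smul]
          have := h.lin (ℜ T).2 (ℑ T).2 z.re (-z.im)
          rw [neg_smul, ← sub_eq_add_neg] at this
          rw [neg_mul, ← sub_eq_add_neg] at this
          exact this
        have r2 : E (ℑ (z • T) : H →L[ℂ] H) = z.re * E (ℑ T : H →L[ℂ] H) + z.im * E (ℜ T : H →L[ℂ] H) := by
          rw [imaginaryPart_smul]
          exact h.lin (ℑ T).2 (ℜ T).2 z.re z.im
        rw [r1, r2]
        apply Complex.ext <;> simp <;> ring }
  refine ⟨L.mkContinuous (2 * E 1) ?_, fun T => rfl⟩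
  intro T
  have n1 : ‖(ℜ T : H →L[ℂ] H)‖ ≤ ‖T‖ := realPart.norm_le T
  have n2 : ‖(ℑ T : H →L[ℂ] H)‖ ≤ ‖T‖ := imaginaryPart.norm_le T
  have b1 := h.bound hp (ℜ T).2
  have b2 := h.bound hp (ℑ T).2
  calc ‖L T‖ ≤ ‖(E (ℜ T : H →L[ℂ] H) : ℂ)‖ + ‖(E (ℑ T : H →L[ℂ] H) : ℂ) * Complex.I‖ := norm_add_le _ _
    _ = |E (ℜ T : H →L[ℂ] H)| + |E (ℑ T : H →L[ℂ] H)| := by simp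
    _ ≤ E 1 * ‖T‖ + E 1 * ‖T‖ := add_le_add (b1.trans (by gcongr)) (b2.trans (by gcongr))
    _ = 2 * E 1 * ‖T‖ := by ring

lemma VNLin.direct {E : (H →L[ℂ] H) → ℝ} (h : VNLin E)
    (hp : ∀ A : H →L[ℂ] H, A.IsPositive → 0 ≤ E A) {ι : Type*} [Countable ι]
    (b : HilbertBasis ι ℂ H) : ∃ U : H →L[ℂ] H, U.IsPositive ∧
        Summable (fun i => (⟪b i, U (b i)⟫_ℂ).re) ∧
        ∀ A : H →L[ℂ] H, IsSelfAdjoint A →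
          HasSum (fun i => (⟪b i, (U * A) (b i)⟫_ℂ).re) (E A) := by
  obtain ⟨F, hF⟩ := h.exists_ext hp
  let B : H →L⋆[ℂ] H →L[ℂ] ℂ :=
    (ContinuousLinearMap.compL ℂ H (H →L[ℂ] H) ℂ F).comp (rankOne ℂ : H →L[ℂ] H →L⋆[ℂ] H →L[ℂ] H).flip
  have hB : ∀ x y, B x y = F (rankOne ℂ y x) := fun x y => rfl
  let U := continuousLinearMapOfBilin B
  have hU : ∀ x y, ⟪U x, y⟫_ℂ = F (rankOne ℂ y x) := fun x y => by
    rw [continuousLinearMapOfBilin_apply, hB]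
  have hUpos : U.IsPositive := by
    rw [ContinuousLinearMap.isPositive_iff_complex]
    intro x
    have hr : IsSelfAdjoint (rankOne ℂ x x : H →L[ℂ] H) := (isPositive_rankOne_self x).isSelfAdjoint
    have e : ⟪U x, x⟫_ℂ = (E (rankOne ℂ x x) : ℂ) := by
      rw [hU, hF, imaginaryPart_eq_zero_iff.2 hr, hr.coe_realPart]
      simp [h.zero]
    rw [e]
    simp [hp _ (isPositive_rankOne_self x)]
  have key : ∀ A : H →L[ℂ] H, IsSelfAdjoint A →
          HasSum (fun i => (⟪b i, (U * A) (b i)⟫_ℂ).re) (E A) := by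
    intro A hA
    have e : ∀ i, (⟪b i, (U * A) (b i)⟫_ℂ).re = E (ℜ (rankOne ℂ (A (b i)) (b i) : H →L[ℂ] H) : H →L[ℂ] H) := by
      intro i
      have : ⟪b i, (U * A) (b i)⟫_ℂ = ⟪U (b i), A (b i)⟫_ℂ := (hUpos.isSymmetric _ _).symm
      rw [this, hU, hF]
      simp
    simp only [e]
    refine h.hasSum hA (fun i => (ℜ _).2) ?_
    intro x
    have s1 : HasSum (fun i => ⟪b i, x⟫_ℂ • A (b i)) (A x) := by
      simpa [b.repr_apply_apply] using (b.hasSum_repr x).mapL A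
    have s2 : HasSum (fun i => ⟪A (b i), x⟫_ℂ • b i) (A x) := by
      have := b.hasSum_repr (A x)
      simp only [b.repr_apply_apply] at this
      convert this using 3 with i
      exact (ContinuousLinearMap.isSelfAdjoint_iff_isSymmetric.1 hA) _ _
    have s3 := (s1.add s2).const_smul (2⁻¹ : ℝ)
    convert s3 using 1
    · ext i
      rw [realPart_apply_coe, ContinuousLinearMap.star_eq_adjoint, adjoint_rankOne]
      simp
    · rw [← two_smul ℝ, smul_smul]; norm_num
  refine ⟨U, hUpos, ?_, key⟩
  simpa using (key 1 (.one _)).summable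

/-- Parseval. -/
lemma vn_parseval {ι : Type*} (b : HilbertBasis ι ℂ H) (x : H) :
    HasSum (fun i => ‖⟪x, b i⟫_ℂ‖ ^ 2) (‖x‖ ^ 2) := by
  have := (b.hasSum_inner_mul_inner x x).mapL Complex.reCLM
  convert this using 1
  · ext i
    rw [← inner_conj_symm (b i) x, Complex.mul_conj']
    norm_cast
  · rw [inner_self_eq_norm_sq_to_K]
    norm_cast

lemma vn_trExp {ι : Type*} (b : HilbertBasis ι ℂ H) {S : H →L[ℂ] H} (hS : IsSelfAdjoint S)
    (hs : Summable fun i => ‖S (b i)‖ ^ 2) {A : H →L[ℂ] H} (hA : IsSelfAdjoint A) :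
    trExp b (S * S) A = ∑' j, (⟪S (b j), A (S (b j))⟫_ℂ).re := by
  have symS : ∀ x y, ⟪S x, y⟫_ℂ = ⟪x, S y⟫_ℂ :=
    ContinuousLinearMap.isSelfAdjoint_iff_isSymmetric.1 hS
  have symA : ∀ x y, ⟪A x, y⟫_ℂ = ⟪x, A y⟫_ℂ :=
    ContinuousLinearMap.isSelfAdjoint_iff_isSymmetric.1 hA
  let g : ι → ι → ℂ := fun i j => ⟪S (b i), b j⟫_ℂ * ⟪b j, S (A (b i))⟫_ℂ
  have hg' : ∀ i j, g i j = ⟪A (S (b j)), b i⟫_ℂ * ⟪b i, S (b j)⟫_ℂ := by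
    intro i j
    simp only [g]
    rw [symS, mul_comm, symA, symS]
  have rows : ∀ i, HasSum (fun j => (g i j).re) (⟪b i, ((S * S) * A) (b i)⟫_ℂ).re := by
    intro i
    have := (b.hasSum_inner_mul_inner (S (b i)) (S (A (b i)))).mapL Complex.reCLM
    rw [symS] at this
    exact this
  have cols : ∀ j, HasSum (fun i => (g i j).re) (⟪S (b j), A (S (b j))⟫_ℂ).re := by
    intro j
    have := (b.hasSum_inner_mul_inner (A (S (b j))) (S (b j))).mapL Complex.reCLM
    rw [symA] at this
    simp only [hg']
    exact this
  have sum1 : Summable fun p : ι × ι => ‖⟪S (b p.1), b p.2⟫_ℂ‖ ^ 2 := by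
    rw [summable_prod_of_nonneg (fun p => by positivity)]
    refine ⟨fun i => (vn_parseval b (S (b i))).summable, ?_⟩
    simpa only [(vn_parseval b (S (b _))).tsum_eq] using hs
  have sum2 : Summable fun p : ι × ι => ‖⟪A (S (b p.1)), b p.2⟫_ℂ‖ ^ 2 := by
    rw [summable_prod_of_nonneg (fun p => by positivity)]
    refine ⟨fun i => (vn_parseval b (A (S (b i)))).summable, ?_⟩
    simp only [(vn_parseval b (A (S (b _)))).tsum_eq]
    refine Summable.of_nonneg_of_le (fun i => by positivity) (fun i => ?_) (hs.mul_left (‖A‖ ^ 2))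
    rw [← mul_pow]
    gcongr
    exact A.le_opNorm _
  have sum3 : Summable (Function.uncurry fun i j => (g i j).re) := by
    refine Summable.of_norm_bounded (sum1.add ((Equiv.prodComm ι ι).summable_iff.2 sum2)) ?_
    rintro ⟨i, j⟩
    have e : ‖g i j‖ = ‖⟪S (b i), b j⟫_ℂ‖ * ‖⟪A (S (b j)), b i⟫_ℂ‖ := by
      simp only [g]
      rw [norm_mul, ← symS (b j), ← symA (S (b j))]
    have := Complex.abs_re_le_norm (g i j)
    simp only [Function.uncurry, Real.norm_eq_abs, Function.comp, Equiv.prodComm_apply, Prod.swap]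
    nlinarith [sq_nonneg (‖⟪S (b i), b j⟫_ℂ‖ - ‖⟪A (S (b j)), b i⟫_ℂ‖), sq_nonneg ‖⟪S (b i), b j⟫_ℂ‖,
      sq_nonneg ‖⟪A (S (b j)), b i⟫_ℂ‖]
  calc trExp b (S * S) A = ∑' i, ∑' j, (g i j).re := by
        simp only [(rows _).tsum_eq, trExp]
    _ = ∑' j, ∑' i, (g i j).re := (sum3.tsum_comm).symm
    _ = _ := by simp only [(cols _).tsum_eq]

lemma vn_bdd {f : ℕ → H} (hf : Summable f) : ∃ C, ∀ s : Finset ℕ, ‖∑ k ∈ s, f k‖ ≤ C := by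
  classical
  obtain ⟨s, hs⟩ := summable_iff_vanishing_norm.1 hf 1 one_pos
  refine ⟨∑ k ∈ s, ‖f k‖ + 1, fun t => ?_⟩
  rw [← Finset.sum_inter_add_sum_sdiff t s]
  refine (norm_add_le _ _).trans (add_le_add ?_ (hs _ Finset.sdiff_disjoint).le)
  refine (norm_sum_le _ _).trans ?_
  exact Finset.sum_le_sum_of_subset_of_nonneg Finset.inter_subset_right (fun _ _ _ => norm_nonneg _)

lemma vn_converse {ι : Type*} (b : HilbertBasis ι ℂ H) {U : H →L[ℂ] H} (hU : U.IsPositive)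
    (hs : Summable (fun i => (⟪b i, U (b i)⟫_ℂ).re)) :
    (∀ A : H →L[ℂ] H, A.IsPositive → 0 ≤ trExp b U A) ∧ VNLin (trExp b U) := by
  obtain ⟨S, hS, rfl⟩ := CStarAlgebra.nonneg_iff_exists_isSelfAdjoint_and_eq_mul_self.1
    ((ContinuousLinearMap.nonneg_iff_isPositive U).2 hU)
  have symS : ∀ x y, ⟪S x, y⟫_ℂ = ⟪x, S y⟫_ℂ :=
    ContinuousLinearMap.isSelfAdjoint_iff_isSymmetric.1 hS
  have hs' : Summable fun i => ‖S (b i)‖ ^ 2 := by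
    convert hs using 2 with i
    rw [ContinuousLinearMap.mul_apply, ← symS, inner_self_eq_norm_sq_to_K]
    norm_cast
  constructor
  · intro A hA
    rw [vn_trExp b hS hs' hA.isSelfAdjoint]
    exact tsum_nonneg fun i => (Complex.nonneg_iff.1 (hA.inner_nonneg_right _)).1
  · intro A As c hA hAs hsum
    have hq : ∀ {A : H →L[ℂ] H} (i : ι), |(⟪S (b i), A (S (b i))⟫_ℂ).re| ≤ ‖A‖ * ‖S (b i)‖ ^ 2 := by
      intro A i
      refine (Complex.abs_re_le_norm _).trans ((norm_inner_le_norm _ _).trans ?_)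
      have := A.le_opNorm (S (b i))
      nlinarith [norm_nonneg (S (b i))]
    have hsm : ∀ A : H →L[ℂ] H, Summable fun i => (⟪S (b i), A (S (b i))⟫_ℂ).re := fun A =>
      Summable.of_norm_bounded (hs'.mul_left ‖A‖) (fun i => hq i)
    obtain ⟨M, hM⟩ := banach_steinhaus (g := fun s : Finset ℕ => ∑ k ∈ s, c k • As k) (by
      intro x
      obtain ⟨C, hC⟩ := vn_bdd (hsum x).summable
      exact ⟨C, fun s => by simpa using hC s⟩)
    have fin : ∀ s : Finset ℕ, ∑ k ∈ s, c k * trExp b (S * S) (As k)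
        = ∑' i, (⟪S (b i), (∑ k ∈ s, c k • As k) (S (b i))⟫_ℂ).re := by
      intro s
      have e : ∀ i, (⟪S (b i), (∑ k ∈ s, c k • As k) (S (b i))⟫_ℂ).re
          = ∑ k ∈ s, c k * (⟪S (b i), As k (S (b i))⟫_ℂ).re := by
        intro i
        simp [inner_sum, inner_smul_right_eq_smul]
      simp only [e]
      rw [Summable.tsum_finsetSum (fun k _ => (hsm (As k)).mul_left _)]
      refine Finset.sum_congr rfl fun k _ => ?_
      rw [tsum_mul_left, vn_trExp b hS hs' (hAs k)]
    rw [HasSum, SummationFilter.unconditional_filter]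
    simp only [fin]
    rw [vn_trExp b hS hs' hA]
    refine tendsto_tsum_of_dominated_convergence (hs'.mul_left M) (fun i => ?_)
      (Filter.Eventually.of_forall fun s i => ?_)
    · have h1 := ((hsum (S (b i))).mapL (innerSL ℂ (S (b i)))).mapL Complex.reCLM
      rw [HasSum, SummationFilter.unconditional_filter] at h1
      convert h1 using 2 with s
      · simp
      · rfl
    · refine (hq i).trans ?_
      gcongr
      exact hM s

end VNHelpers

/-- Von Neumann's representation theorem: an expectation-value functional on the bounded
self-adjoint operators of a separable complex Hilbert space which is positive and countably
additive/linear w.r.t. strongly convergent sums is of the form `A ↦ Tr(UA)` for a positive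
trace-class operator `U`; conversely, every such functional has these properties. -/
theorem stmt_8 {H : Type*} [NormedAddCommGroup H] [InnerProductSpace ℂ H] [CompleteSpace H]
    {ι : Type*} [Countable ι] (b : HilbertBasis ι ℂ H) :
    (∀ E : (H →L[ℂ] H) → ℝ,
      (∀ A : H →L[ℂ] H, A.IsPositive → 0 ≤ E A) →
      (∀ (A : H →L[ℂ] H) (As : ℕ → H →L[ℂ] H) (c : ℕ → ℝ),
        IsSelfAdjoint A → (∀ k, IsSelfAdjoint (As k)) →
        (∀ x : H, HasSum (fun k => c k • As k x) (A x)) →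
        HasSum (fun k => c k * E (As k)) (E A)) →
      ∃ U : H →L[ℂ] H, U.IsPositive ∧
        Summable (fun i => (⟪b i, U (b i)⟫_ℂ).re) ∧
        ∀ A : H →L[ℂ] H, IsSelfAdjoint A →
          HasSum (fun i => (⟪b i, (U * A) (b i)⟫_ℂ).re) (E A)) ∧
    (∀ U : H →L[ℂ] H, U.IsPositive →
      Summable (fun i => (⟪b i, U (b i)⟫_ℂ).re) →
      (∀ A : H →L[ℂ] H, A.IsPositive → 0 ≤ trExp b U A) ∧
      (∀ (A : H →L[ℂ] H) (As : ℕ → H →L[ℂ] H) (c : ℕ → ℝ),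
        IsSelfAdjoint A → (∀ k, IsSelfAdjoint (As k)) →
        (∀ x : H, HasSum (fun k => c k • As k x) (A x)) →
        HasSum (fun k => c k * trExp b U (As k)) (trExp b U A))) := by
  exact ⟨fun E hp h => VNLin.direct h hp b, fun U hU hs => vn_converse b hU hs⟩
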